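/- For every λ ∈ ℂ ∖ {0} and every s ∈ ℂ, the following identity holds in S: Ω(λ) = F·(E − κs(K − λ⁻¹K′)) + κ(qK − q⁻¹λ⁻¹K′)·(sF + κ(K − λK′)), where Ω(λ) = EF + κ²(q⁻¹K − qλK′)(K − λ⁻¹K′). Consequently Ω(λ) belongs to the left ideal S·(E − κs(K − λ⁻¹K′)) + S·(sF + κ(K − λK′)), and hence the central element Ω(λ) annihilates the cyclic left S-module S/(S·(E − κs(K − λ⁻¹K′)) + S·(sF + κ(K − λK′))). -/

import Mathlib

noncomputable section

open FreeAlgebra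

/-- The defining relations of the algebra `S`.
Generators: `0 ↦ E`, `1 ↦ F`, `2 ↦ K`, `3 ↦ K′`. -/
inductive SRel (q : ℂ) : FreeAlgebra ℂ (Fin 4) → FreeAlgebra ℂ (Fin 4) → Prop
  | KE : SRel q (ι ℂ 2 * ι ℂ 0) (q • (ι ℂ 0 * ι ℂ 2))
  | KF : SRel q (ι ℂ 2 * ι ℂ 1) (q⁻¹ • (ι ℂ 1 * ι ℂ 2))
  | KK' : SRel q (ι ℂ 2 * ι ℂ 3) (ι ℂ 3 * ι ℂ 2)
  | K'E : SRel q (ι ℂ 3 * ι ℂ 0) (q⁻¹ • (ι ℂ 0 * ι ℂ 3))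
  | K'F : SRel q (ι ℂ 3 * ι ℂ 1) (q • (ι ℂ 1 * ι ℂ 3))
  | EF : SRel q ((q - q⁻¹) • (ι ℂ 0 * ι ℂ 1 - ι ℂ 1 * ι ℂ 0))
      (ι ℂ 2 * ι ℂ 2 - ι ℂ 3 * ι ℂ 3)

/-- The algebra `S`, presented by generators `E, F, K, K′` and the relations above. -/
abbrev SAlg (q : ℂ) : Type := RingQuot (SRel q)

/-- The generator `E` of `S`. -/
def gE (q : ℂ) : SAlg q := RingQuot.mkAlgHom ℂ (SRel q) (ι ℂ 0)

/-- The generator `F` of `S`. -/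
def gF (q : ℂ) : SAlg q := RingQuot.mkAlgHom ℂ (SRel q) (ι ℂ 1)

/-- The generator `K` of `S`. -/
def gK (q : ℂ) : SAlg q := RingQuot.mkAlgHom ℂ (SRel q) (ι ℂ 2)

/-- The generator `K′` of `S`. -/
def gK' (q : ℂ) : SAlg q := RingQuot.mkAlgHom ℂ (SRel q) (ι ℂ 3)


/-- The central element `Ω(λ) = EF + κ²(q⁻¹K − qλK′)(K − λ⁻¹K′)`. -/
def Omega (q κ l : ℂ) : SAlg q :=
  gE q * gF q + κ ^ 2 • ((q⁻¹ • gK q - (q * l) • gK' q) * (gK q - l⁻¹ • gK' q))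

section Omega

variable {q κ : ℂ}

theorem gK_mul_gE (q : ℂ) : gK q * gE q = q • (gE q * gK q) := by
  simpa [gK, gE] using RingQuot.mkAlgHom_rel ℂ (SRel.KE (q := q))

theorem gK_mul_gF (q : ℂ) : gK q * gF q = q⁻¹ • (gF q * gK q) := by
  simpa [gK, gF] using RingQuot.mkAlgHom_rel ℂ (SRel.KF (q := q))

theorem gK'_mul_gK (q : ℂ) : gK' q * gK q = gK q * gK' q := by
  simpa [gK, gK'] using (RingQuot.mkAlgHom_rel ℂ (SRel.KK' (q := q))).symm

theorem gK'_mul_gE (q : ℂ) : gK' q * gE q = q⁻¹ • (gE q * gK' q) := by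
  simpa [gK', gE] using RingQuot.mkAlgHom_rel ℂ (SRel.K'E (q := q))

theorem gK'_mul_gF (q : ℂ) : gK' q * gF q = q • (gF q * gK' q) := by
  simpa [gK', gF] using RingQuot.mkAlgHom_rel ℂ (SRel.K'F (q := q))

theorem inv_sub_self_ne_zero (hq0 : q ≠ 0) (hq1 : q ≠ 1) (hqm1 : q ≠ -1) : q⁻¹ - q ≠ 0 := by
  intro h
  have h' : q * q = 1 := by
    field_simp at h
    linear_combination -h
  rcases mul_self_eq_one_iff.mp h' with h | h
  exacts [hq1 h, hqm1 h]

theorem gF_mul_gE (hκ : κ * (q⁻¹ - q) = 1) :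
    gF q * gE q = gE q * gF q + κ • (gK q * gK q - gK' q * gK' q) := by
  have h : (q - q⁻¹) • (gE q * gF q - gF q * gE q) = gK q * gK q - gK' q * gK' q := by
    simpa [gE, gF, gK, gK'] using RingQuot.mkAlgHom_rel ℂ (SRel.EF (q := q))
  have hκ' : κ * (q - q⁻¹) = -1 := by linear_combination -hκ
  rw [← h, smul_smul, hκ']
  module

theorem mul_mul_of_mul_eq_smul {A : Type*} [Ring A] [Algebra ℂ A] {a b : A} {c : ℂ}
    (h : a * b = c • (b * a)) (x : A) : a * (b * x) = c • (b * (a * x)) := by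
  rw [← mul_assoc, h, smul_mul_assoc, mul_assoc]

theorem Omega_eq (hq0 : q ≠ 0) (hκ : κ * (q⁻¹ - q) = 1) {l : ℂ} (hl : l ≠ 0) (s : ℂ) :
    Omega q κ l
      = gF q * (gE q - (κ * s) • (gK q - l⁻¹ • gK' q))
        + (κ • (q • gK q - (q⁻¹ * l⁻¹) • gK' q))
          * (s • gF q + κ • (gK q - l • gK' q)) := by
  have hκ' : κ * (1 - q ^ 2) = q := by
    field_simp at hκ
    exact hκ
  simp only [Omega, mul_add, mul_sub, sub_mul, smul_mul_assoc, mul_smul_comm,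
    gK_mul_gF, gK'_mul_gF, gK'_mul_gK, gF_mul_gE hκ]
  match_scalars <;> field_simp <;> grind

theorem Omega_commute_gE (hq0 : q ≠ 0) (hκ : κ * (q⁻¹ - q) = 1) {l : ℂ} (hl : l ≠ 0) :
    Omega q κ l * gE q = gE q * Omega q κ l := by
  have hκ' : κ * (1 - q ^ 2) = q := by
    field_simp at hκ
    exact hκ
  simp only [Omega, mul_add, add_mul, mul_sub, sub_mul, smul_mul_assoc, mul_smul_comm, mul_assoc,
    gK_mul_gE, gK'_mul_gE, gK'_mul_gK, gF_mul_gE hκ, mul_mul_of_mul_eq_smul (gK_mul_gE q),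
    mul_mul_of_mul_eq_smul (gK'_mul_gE q)]
  match_scalars <;> field_simp <;> grind

theorem Omega_commute_gF (hq0 : q ≠ 0) (hκ : κ * (q⁻¹ - q) = 1) {l : ℂ} (hl : l ≠ 0) :
    Omega q κ l * gF q = gF q * Omega q κ l := by
  have hκ' : κ * (1 - q ^ 2) = q := by
    field_simp at hκ
    exact hκ
  have hFE : gF q * (gE q * gF q) =
      gE q * (gF q * gF q) + κ • (gK q * (gK q * gF q) - gK' q * (gK' q * gF q)) := by
    simp only [← mul_assoc, gF_mul_gE hκ, add_mul, sub_mul, smul_mul_assoc]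
  simp only [Omega, mul_add, add_mul, mul_sub, sub_mul, smul_mul_assoc, mul_smul_comm, mul_assoc,
    hFE, gK_mul_gF, gK'_mul_gF, gK'_mul_gK, mul_mul_of_mul_eq_smul (gK_mul_gF q),
    mul_mul_of_mul_eq_smul (gK'_mul_gF q)]
  match_scalars <;> field_simp <;> grind

theorem Omega_commute_gK (hq0 : q ≠ 0) (l : ℂ) :
    Omega q κ l * gK q = gK q * Omega q κ l := by
  have hK (x : SAlg q) : gK' q * (gK q * x) = gK q * (gK' q * x) := by
    rw [← mul_assoc, gK'_mul_gK, mul_assoc]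
  simp only [Omega, mul_add, add_mul, mul_sub, sub_mul, smul_mul_assoc, mul_smul_comm, mul_assoc,
    gK_mul_gF, gK'_mul_gK, mul_mul_of_mul_eq_smul (gK_mul_gE q), hK]
  match_scalars <;> field_simp

theorem Omega_commute_gK' (hq0 : q ≠ 0) (l : ℂ) :
    Omega q κ l * gK' q = gK' q * Omega q κ l := by
  have hK (x : SAlg q) : gK' q * (gK q * x) = gK q * (gK' q * x) := by
    rw [← mul_assoc, gK'_mul_gK, mul_assoc]
  simp only [Omega, mul_add, add_mul, mul_sub, sub_mul, smul_mul_assoc, mul_smul_comm, mul_assoc,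
    gK'_mul_gF, gK'_mul_gK, mul_mul_of_mul_eq_smul (gK'_mul_gE q), hK]
  match_scalars <;> field_simp

theorem Omega_commute (hq0 : q ≠ 0) (hκ : κ * (q⁻¹ - q) = 1) {l : ℂ} (hl : l ≠ 0) (x : SAlg q) :
    Commute (Omega q κ l) x := by
  obtain ⟨y, rfl⟩ := RingQuot.mkAlgHom_surjective ℂ (SRel q) x
  induction y using FreeAlgebra.induction with
  | grade0 r => simpa using Algebra.commute_algebraMap_right r _
  | grade1 i =>
    fin_cases i
    exacts [Omega_commute_gE hq0 hκ hl, Omega_commute_gF hq0 hκ hl,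
      Omega_commute_gK hq0 l, Omega_commute_gK' hq0 l]
  | mul a b ha hb => simpa using ha.mul_right hb
  | add a b ha hb => simpa using ha.add_right hb

end Omega

/-- For every `λ ∈ ℂ ∖ {0}` and `s ∈ ℂ`:
`Ω(λ) = F·(E − κs(K − λ⁻¹K′)) + κ(qK − q⁻¹λ⁻¹K′)·(sF + κ(K − λK′))`,
hence `Ω(λ)` lies in the left ideal generated by `E − κs(K − λ⁻¹K′)` and
`sF + κ(K − λK′)`, and hence the central element `Ω(λ)` annihilates the cyclic left
`S`-module `S/(S·(E − κs(K − λ⁻¹K′)) + S·(sF + κ(K − λK′)))`. -/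
theorem stmt_12 (q : ℂ) (hq0 : q ≠ 0) (hq1 : q ≠ 1) (hqm1 : q ≠ -1)
    (κ : ℂ) (hκ : κ = (q⁻¹ - q)⁻¹) (l : ℂ) (hl : l ≠ 0) (s : ℂ) :
    Omega q κ l
      = gF q * (gE q - (κ * s) • (gK q - l⁻¹ • gK' q))
        + (κ • (q • gK q - (q⁻¹ * l⁻¹) • gK' q))
          * (s • gF q + κ • (gK q - l • gK' q))
    ∧ Omega q κ l ∈
        (Submodule.span (SAlg q)
          {gE q - (κ * s) • (gK q - l⁻¹ • gK' q),
           s • gF q + κ • (gK q - l • gK' q)} : Submodule (SAlg q) (SAlg q))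
    ∧ ∀ x : SAlg q ⧸
        (Submodule.span (SAlg q)
          {gE q - (κ * s) • (gK q - l⁻¹ • gK' q),
           s • gF q + κ • (gK q - l • gK' q)} : Submodule (SAlg q) (SAlg q)),
        Omega q κ l • x = 0 := by
  have hκ' : κ * (q⁻¹ - q) = 1 := by
    rw [hκ, inv_mul_cancel₀ (inv_sub_self_ne_zero hq0 hq1 hqm1)]
  have hΩ := Omega_eq hq0 hκ' hl s
  have hmem : Omega q κ l ∈ Submodule.span (SAlg q)
      {gE q - (κ * s) • (gK q - l⁻¹ • gK' q), s • gF q + κ • (gK q - l • gK' q)} :=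
    Submodule.mem_span_pair.mpr ⟨_, _, hΩ.symm⟩
  refine ⟨hΩ, hmem, fun x => ?_⟩
  obtain ⟨y, rfl⟩ := Submodule.Quotient.mk_surjective _ x
  rw [← Submodule.Quotient.mk_smul, Submodule.Quotient.mk_eq_zero, smul_eq_mul,
    (Omega_commute hq0 hκ' hl y).eq]
  exact Submodule.smul_mem _ y hmem
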